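/- Let d ≥ 3 and 2q > d, and define V : ℤ^d → [0,∞) by V(x) = |x|^{−2}·(log|x|)^{−1/q} for |x| > 1 and V(x) = 0 for |x| ≤ 1. Then: (a) there is a constant C with n(s,V) ≤ C·s^{−q} for all s > 0; and (b) limsup_{s→0⁺} s^q · n(s,V) > 0, i.e. it is not the case that s^q n(s,V) → 0 as s → 0⁺. Equivalently, N₋(H_{αV}) = O(α^q) but N₋(H_{αV}) ≠ o(α^q) as α → ∞; the estimate (a) is order-sharp for this potential. -/

import Mathlib

open scoped ENNReal NNReal Topology
open Filter MeasureTheory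

noncomputable section

/-- The lattice point `1_j` in `ℤ^d`: `j`-th coordinate `1`, all others `0`. -/
def latUnit (d : ℕ) (j : Fin d) : Fin d → ℤ := fun i => if i = j then 1 else 0

/-- The discrete Dirichlet form `Q_0[u] = Σ_x Σ_j |u(x+1_j) − u(x)|²`, valued in `[0,∞]`. -/
def Q0 {d : ℕ} (u : (Fin d → ℤ) → ℂ) : ℝ≥0∞ :=
  ∑' x : Fin d → ℤ, ∑ j : Fin d, ((‖u (x + latUnit d j) - u x‖₊ : ℝ≥0∞)) ^ 2

/-- `b_V[u] = Σ_x V(x)|u(x)|²`, valued in `[0,∞]`. -/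
def bV {d : ℕ} (V : (Fin d → ℤ) → ℝ) (u : (Fin d → ℤ) → ℂ) : ℝ≥0∞ :=
  ∑' x : Fin d → ℤ, ENNReal.ofReal (V x) * ((‖u x‖₊ : ℝ≥0∞)) ^ 2

/-- The Euclidean norm `|x|` of a lattice point. -/
def znorm {d : ℕ} (x : Fin d → ℤ) : ℝ := Real.sqrt (∑ i, ((x i : ℝ)) ^ 2)

/-- The counting function `n(s,V)`: the supremum, in `ℕ∞`, of `dim L` over all
finite-dimensional subspaces `L` of the space of finitely supported functions with
`b_V[u] > s·Q_0[u]` for all nonzero `u ∈ L` (the `s`-admissible subspaces). -/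
def nCount (d : ℕ) (V : (Fin d → ℤ) → ℝ) (s : ℝ) : ℕ∞ :=
  ⨆ L : {L : Submodule ℂ ((Fin d → ℤ) → ℂ) //
      (∀ u ∈ L, (Function.support u).Finite) ∧ FiniteDimensional ℂ L ∧
      ∀ u ∈ L, u ≠ 0 → ENNReal.ofReal s * Q0 u < bV V u},
    (Module.finrank ℂ L.1 : ℕ∞)

/-- `ν(s,V)`: the number (in `ℕ∞`) of lattice points with `V(x) > s`. -/
def nuCount (d : ℕ) (V : (Fin d → ℤ) → ℝ) (s : ℝ) : ℕ∞ :=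
  {x : Fin d → ℤ | s < V x}.encard

/-- The potential `V(x) = |x|^{−2} (log|x|)^{−1/q}` for `|x| > 1`, `V(x) = 0` otherwise. -/
def exPot (d : ℕ) (q : ℝ) : (Fin d → ℤ) → ℝ := fun x =>
  if 1 < znorm x then znorm x ^ (-2 : ℝ) * Real.log (znorm x) ^ (-(1 / q)) else 0

/-- The squared length of the discrete gradient at `x`. -/
def gradSq {d : ℕ} (u : (Fin d → ℤ) → ℂ) (x : Fin d → ℤ) : ℝ :=
  ∑ j : Fin d, ‖u (x + latUnit d j) - u x‖ ^ 2

/-- The squared Euclidean norm of a lattice point. -/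
def normSqZ {d : ℕ} (x : Fin d → ℤ) : ℝ := ∑ i, ((x i : ℝ)) ^ 2

section Basics

variable {d : ℕ} {u : (Fin d → ℤ) → ℂ}

lemma gradSq_nonneg (u : (Fin d → ℤ) → ℂ) (x : Fin d → ℤ) : 0 ≤ gradSq u x :=
  Finset.sum_nonneg fun _ _ => by positivity

lemma normSqZ_nonneg (x : Fin d → ℤ) : 0 ≤ normSqZ x :=
  Finset.sum_nonneg fun _ _ => by positivity

lemma finite_support_shift (hu : (Function.support u).Finite) (e : Fin d → ℤ) :
    (Function.support fun x => u (x + e)).Finite :=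
  hu.preimage (f := fun x => x + e) (add_left_injective e).injOn

lemma summable_of_finite_support_mul (hu : (Function.support u).Finite)
    (w : (Fin d → ℤ) → ℝ) : Summable fun x => w x * ‖u x‖ ^ 2 := by
  refine summable_of_hasFiniteSupport (hu.subset fun x hx => ?_)
  contrapose! hx
  simp_all

lemma summable_diffSq (hu : (Function.support u).Finite) (e : Fin d → ℤ) :
    Summable fun x => ‖u (x + e) - u x‖ ^ 2 := by
  refine summable_of_hasFiniteSupport (((finite_support_shift hu e).union hu).subset fun x hx => ?_)
  contrapose! hx
  simp_all

lemma summable_gradSq (hu : (Function.support u).Finite) : Summable (gradSq u) :=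
  summable_sum fun j _ => summable_diffSq hu (latUnit d j)

lemma Q0_eq_ofReal (hu : (Function.support u).Finite) :
    Q0 u = ENNReal.ofReal (∑' x, gradSq u x) := by
  rw [ENNReal.ofReal_tsum_of_nonneg (gradSq_nonneg u) (summable_gradSq hu), Q0]
  refine tsum_congr fun x => ?_
  rw [gradSq, ENNReal.ofReal_sum_of_nonneg fun _ _ => by positivity]
  refine Finset.sum_congr rfl fun j _ => ?_
  rw [ENNReal.ofReal_pow (norm_nonneg _), ofReal_norm, enorm_eq_nnnorm]

lemma bV_eq_ofReal (hu : (Function.support u).Finite) {V : (Fin d → ℤ) → ℝ} (hV : ∀ x, 0 ≤ V x) :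
    bV V u = ENNReal.ofReal (∑' x, V x * ‖u x‖ ^ 2) := by
  rw [ENNReal.ofReal_tsum_of_nonneg (fun x => mul_nonneg (hV x) (by positivity))
    (summable_of_finite_support_mul hu V), bV]
  refine tsum_congr fun x => ?_
  rw [ENNReal.ofReal_mul (hV x), ENNReal.ofReal_pow (norm_nonneg _), ofReal_norm,
    enorm_eq_nnnorm]

lemma exPot_nonneg (q : ℝ) (x : Fin d → ℤ) : 0 ≤ exPot d q x := by
  unfold exPot
  split_ifs with h
  · have := Real.log_pos h
    have : 0 < znorm x := by linarith
    positivity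
  · exact le_rfl

lemma znorm_sq (x : Fin d → ℤ) : znorm x ^ 2 = normSqZ x :=
  Real.sq_sqrt (normSqZ_nonneg x)

end Basics

section Hardy

variable {d : ℕ}

lemma normSqZ_add_latUnit (x : Fin d → ℤ) (j : Fin d) :
    normSqZ (x + latUnit d j) = normSqZ x + 2 * x j + 1 := by
  have h : ∀ i, (((x + latUnit d j) i : ℤ) : ℝ) ^ 2
      = (x i : ℝ) ^ 2 + (if i = j then 2 * (x i : ℝ) + 1 else 0) := by
    intro i
    simp only [Pi.add_apply, latUnit]
    split_ifs <;> push_cast <;> ring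
  simp only [normSqZ, h, Finset.sum_add_distrib, Finset.sum_ite_eq', Finset.mem_univ, if_true]
  ring

lemma sq_le_normSqZ (x : Fin d → ℤ) (j : Fin d) : (x j : ℝ) ^ 2 ≤ normSqZ x :=
  Finset.single_le_sum (f := fun i => (x i : ℝ) ^ 2) (fun _ _ => by positivity) (Finset.mem_univ j)

/-- The weighted arithmetic-geometric mean inequality behind the ground state substitution. -/
lemma weighted_le_norm_sub_sq (u v : ℂ) {m n : ℝ} (hm : 0 < m) (hn : 0 < n) :
    (1 - m / n) * ‖u‖ ^ 2 + (1 - n / m) * ‖v‖ ^ 2 ≤ ‖v - u‖ ^ 2 := by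
  have h1 : (‖v‖ - ‖u‖) ^ 2 ≤ ‖v - u‖ ^ 2 := by
    rw [sq_le_sq, abs_of_nonneg (norm_nonneg (v - u))]
    exact abs_norm_sub_norm_le v u
  refine le_trans ?_ h1
  have h2 : (‖v‖ - ‖u‖) ^ 2 - ((1 - m / n) * ‖u‖ ^ 2 + (1 - n / m) * ‖v‖ ^ 2)
      = (m * ‖u‖ - n * ‖v‖) ^ 2 / (m * n) := by
    field_simp
    ring
  have h3 : 0 ≤ (m * ‖u‖ - n * ‖v‖) ^ 2 / (m * n) := by positivity
  linarith

lemma hardy_weight_coord {t P : ℝ} (hP : 11 ≤ P) (ht : t ^ 2 ≤ P - 11) :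
    1 / 2 * (1 / P - 11 / 4 * t ^ 2 / P ^ 2) ≤
      2 * (1 + 2 * t) / (8 * P + 10 * t) + 2 * (1 - 2 * t) / (8 * P - 10 * t) := by
  have h0 : 0 < P := by linarith
  have h1 : 0 < 8 * P + 10 * t := by nlinarith [sq_nonneg (t + 1)]
  have h2 : 0 < 8 * P - 10 * t := by nlinarith [sq_nonneg (t - 1)]
  have h3 : 0 < 16 * P ^ 2 - 25 * t ^ 2 := by nlinarith
  have e : 2 * (1 + 2 * t) / (8 * P + 10 * t) + 2 * (1 - 2 * t) / (8 * P - 10 * t)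
      = (8 * P - 20 * t ^ 2) / (16 * P ^ 2 - 25 * t ^ 2) := by
    rw [div_add_div _ _ h1.ne' h2.ne', div_eq_div_iff (by positivity) h3.ne']
    ring
  have e2 : 1 / 2 * (1 / P - 11 / 4 * t ^ 2 / P ^ 2) = (4 * P - 11 * t ^ 2) / (8 * P ^ 2) := by
    field_simp
    ring
  rw [e, e2, div_le_div_iff₀ (by positivity) h3]
  have h4 : 275 * t ^ 2 ≤ 16 * P ^ 2 + 100 * P := by nlinarith
  nlinarith [mul_le_mul_of_nonneg_left h4 (sq_nonneg t)]

/-- A discrete Hardy inequality. -/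
lemma hardy (hd : 3 ≤ d) {u : (Fin d → ℤ) → ℂ} (hu : (Function.support u).Finite) :
    ∑' x, (1 / (normSqZ x + 12)) * ‖u x‖ ^ 2 ≤ 8 * ∑' x, gradSq u x := by
  let P : (Fin d → ℤ) → ℝ := fun x => normSqZ x + 11 + 5 / 8
  let F : Fin d → (Fin d → ℤ) → ℝ := fun j x => 2 * (1 + 2 * (x j : ℝ)) / (8 * P x + 10 * x j)
  let G : Fin d → (Fin d → ℤ) → ℝ := fun j x => 2 * (1 - 2 * (x j : ℝ)) / (8 * P x - 10 * x j)
  have hPpos : ∀ x, 11 + 5 / 8 ≤ P x := fun x => by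
    have := normSqZ_nonneg x
    simp only [P]; linarith
  have edge : ∀ j x, F j x * ‖u x‖ ^ 2 + G j (x + latUnit d j) * ‖u (x + latUnit d j)‖ ^ 2
      ≤ ‖u (x + latUnit d j) - u x‖ ^ 2 := by
    intro j x
    have hy := normSqZ_add_latUnit x j
    have hx0 := normSqZ_nonneg x
    have hy0 := normSqZ_nonneg (x + latUnit d j)
    have := weighted_le_norm_sub_sq (u x) (u (x + latUnit d j))
      (m := 5 * (normSqZ x + 11) + 3 * (normSqZ (x + latUnit d j) + 11))
      (n := 3 * (normSqZ x + 11) + 5 * (normSqZ (x + latUnit d j) + 11))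
      (by positivity) (by positivity)
    refine le_of_eq_of_le ?_ this
    have hj : ((x + latUnit d j) j : ℤ) = x j + 1 := by simp [latUnit]
    simp only [F, G, P, hj]
    push_cast
    congr 2
    · rw [eq_sub_iff_add_eq, show 8 * (normSqZ x + 11 + 5 / 8) + 10 * (x j : ℝ)
        = 3 * (normSqZ x + 11) + 5 * (normSqZ (x + latUnit d j) + 11) by rw [hy]; ring,
        ← add_div, div_eq_one_iff_eq (by positivity), hy]
      ring
    · rw [eq_sub_iff_add_eq, show 8 * (normSqZ (x + latUnit d j) + 11 + 5 / 8)
          - 10 * ((x j : ℝ) + 1)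
        = 5 * (normSqZ x + 11) + 3 * (normSqZ (x + latUnit d j) + 11) by rw [hy]; ring,
        ← add_div, div_eq_one_iff_eq (by positivity), hy]
      ring
  have hsum : ∀ j, ∑' x, (F j x + G j x) * ‖u x‖ ^ 2
      ≤ ∑' x, ‖u (x + latUnit d j) - u x‖ ^ 2 := by
    intro j
    have hG := summable_of_finite_support_mul hu (G j)
    have hF := summable_of_finite_support_mul hu (F j)
    clear_value F G
    have hshift : ∑' x, G j (x + latUnit d j) * ‖u (x + latUnit d j)‖ ^ 2
        = ∑' x, G j x * ‖u x‖ ^ 2 :=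
      (Equiv.addRight (latUnit d j)).tsum_eq fun x => G j x * ‖u x‖ ^ 2
    have hG' : Summable fun x => G j (x + latUnit d j) * ‖u (x + latUnit d j)‖ ^ 2 :=
      summable_of_finite_support_mul (finite_support_shift hu (latUnit d j))
        fun x => G j (x + latUnit d j)
    simp only [add_mul]
    rw [hF.tsum_add hG, ← hshift, ← hF.tsum_add hG']
    exact Summable.tsum_le_tsum (edge j) (hF.add hG') (summable_diffSq hu _)
  have hpt : ∀ x, 1 / (normSqZ x + 12) ≤ 8 * ∑ j, (F j x + G j x) := by
    intro x
    have hP := hPpos x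
    have hP0 : 0 < P x := by linarith
    have hx0 := normSqZ_nonneg x
    have h1 : ∑ j, (1 / 2 * (1 / P x - 11 / 4 * (x j : ℝ) ^ 2 / P x ^ 2))
        ≤ ∑ j, (F j x + G j x) := by
      refine Finset.sum_le_sum fun j _ => hardy_weight_coord (by linarith) ?_
      have := sq_le_normSqZ x j
      simp only [P]; linarith
    have h2 : ∑ j, (1 / 2 * (1 / P x - 11 / 4 * (x j : ℝ) ^ 2 / P x ^ 2))
        = 1 / 2 * (d / P x - 11 / 4 * normSqZ x / P x ^ 2) := by
      rw [← Finset.mul_sum, Finset.sum_sub_distrib, ← Finset.sum_div _ _ (P x ^ 2), ← Finset.mul_sum]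
      simp [normSqZ, div_eq_mul_inv]
    have h3 : 1 / (normSqZ x + 12) ≤ 1 / P x :=
      one_div_le_one_div_of_le hP0 (by simp only [P]; linarith)
    have hd' : (3 : ℝ) ≤ d := by exact_mod_cast hd
    have h4 : 3 / P x ≤ d / P x := by gcongr
    have h5 : 11 / 4 * normSqZ x / P x ^ 2 ≤ 11 / 4 / P x := by
      rw [div_le_div_iff₀ (by positivity) hP0]
      have : normSqZ x ≤ P x := by simp only [P]; linarith
      nlinarith [mul_le_mul_of_nonneg_right this hP0.le]
    have h6 : 3 / P x = 3 * (1 / P x) := by ring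
    have h7 : 11 / 4 / P x = 11 / 4 * (1 / P x) := by ring
    linarith
  calc ∑' x, (1 / (normSqZ x + 12)) * ‖u x‖ ^ 2
      ≤ ∑' x, (8 * ∑ j, (F j x + G j x)) * ‖u x‖ ^ 2 :=
        (summable_of_finite_support_mul hu _).tsum_le_tsum
          (fun x => mul_le_mul_of_nonneg_right (hpt x) (by positivity))
          (summable_of_finite_support_mul hu _)
    _ = 8 * ∑ j, ∑' x, (F j x + G j x) * ‖u x‖ ^ 2 := by
        rw [← Summable.tsum_finsetSum fun j _ => summable_of_finite_support_mul hu _,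
          ← tsum_mul_left]
        refine tsum_congr fun x => ?_
        rw [← Finset.sum_mul, mul_assoc]
    _ ≤ 8 * ∑ j, ∑' x, ‖u (x + latUnit d j) - u x‖ ^ 2 := by
        exact mul_le_mul_of_nonneg_left (Finset.sum_le_sum fun j _ => hsum j) (by norm_num)
    _ = 8 * ∑' x, gradSq u x := by
        rw [← Summable.tsum_finsetSum fun j _ => summable_diffSq hu _]
        rfl

end Hardy

section Poincare

lemma norm_sub_sq_le_sum_range (f : ℕ → ℂ) {ℓ s t : ℕ} (hs : s < ℓ) (ht : t < ℓ) :
    ‖f s - f t‖ ^ 2 ≤ ℓ * ∑ r ∈ Finset.range ℓ, ‖f (r + 1) - f r‖ ^ 2 := by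
  wlog hst : s ≤ t generalizing s t
  · rw [norm_sub_rev]
    exact this ht hs (le_of_not_ge hst)
  have h1 : ‖f s - f t‖ ≤ ∑ r ∈ Finset.range ℓ, ‖f (r + 1) - f r‖ := by
    rw [← dist_eq_norm]
    refine (dist_le_Ico_sum_dist f hst).trans ?_
    simp only [dist_eq_norm, norm_sub_rev (f _) (f (_ + 1))]
    refine Finset.sum_le_sum_of_subset_of_nonneg (fun r hr => ?_) fun _ _ _ => norm_nonneg _
    simp only [Finset.mem_Ico, Finset.mem_range] at hr ⊢
    omega
  calc ‖f s - f t‖ ^ 2 ≤ (∑ r ∈ Finset.range ℓ, ‖f (r + 1) - f r‖) ^ 2 := by gcongr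
    _ ≤ (Finset.range ℓ).card * ∑ r ∈ Finset.range ℓ, ‖f (r + 1) - f r‖ ^ 2 :=
      sq_sum_le_card_mul_sum_sq
    _ = _ := by rw [Finset.card_range]

lemma sum_sum_norm_sub_sq {ι : Type*} (S : Finset ι) (f : ι → ℂ) :
    ∑ s ∈ S, ∑ t ∈ S, ‖f s - f t‖ ^ 2
      = 2 * S.card * ∑ t ∈ S, ‖f t‖ ^ 2 - 2 * ‖∑ t ∈ S, f t‖ ^ 2 := by
  have h : ∀ s t, ‖f s - f t‖ ^ 2
      = ‖f s‖ ^ 2 - 2 * RCLike.re (inner ℂ (f s) (f t)) + ‖f t‖ ^ 2 := fun s t =>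
    norm_sub_sq (𝕜 := ℂ) _ _
  have h2 : ∑ s ∈ S, ∑ t ∈ S, RCLike.re (inner ℂ (f s) (f t)) = ‖∑ t ∈ S, f t‖ ^ 2 := by
    rw [norm_sq_eq_re_inner (𝕜 := ℂ), sum_inner, map_sum]
    simp only [inner_sum, map_sum]
  simp only [h, Finset.sum_add_distrib, Finset.sum_sub_distrib, ← Finset.mul_sum,
    Finset.sum_const, nsmul_eq_mul, h2]
  ring

/-- One-dimensional Poincaré inequality on an interval of `ℓ` points. -/
lemma poincare_range (f : ℕ → ℂ) (ℓ : ℕ) :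
    ℓ * ∑ t ∈ Finset.range ℓ, ‖f t‖ ^ 2 ≤ ‖∑ t ∈ Finset.range ℓ, f t‖ ^ 2
      + (ℓ : ℝ) ^ 3 * ∑ t ∈ Finset.range ℓ, ‖f (t + 1) - f t‖ ^ 2 := by
  have h := sum_sum_norm_sub_sq (Finset.range ℓ) f
  have h2 : ∑ s ∈ Finset.range ℓ, ∑ t ∈ Finset.range ℓ, ‖f s - f t‖ ^ 2
      ≤ ∑ s ∈ Finset.range ℓ, ∑ t ∈ Finset.range ℓ,
        (ℓ * ∑ r ∈ Finset.range ℓ, ‖f (r + 1) - f r‖ ^ 2) :=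
    Finset.sum_le_sum fun s hs => Finset.sum_le_sum fun t ht =>
      norm_sub_sq_le_sum_range f (Finset.mem_range.mp hs) (Finset.mem_range.mp ht)
  rw [h] at h2
  simp only [Finset.sum_const, Finset.card_range, nsmul_eq_mul] at h2
  have : 0 ≤ (ℓ : ℝ) ^ 3 * ∑ t ∈ Finset.range ℓ, ‖f (t + 1) - f t‖ ^ 2 := by positivity
  nlinarith

lemma sum_piFinset_cons {M : Type*} [AddCommMonoid M] {d : ℕ} (S : Finset ℕ)
    (f : (Fin (d + 1) → ℕ) → M) :
    ∑ p ∈ Fintype.piFinset (fun _ => S), f p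
      = ∑ t ∈ S, ∑ p ∈ Fintype.piFinset (fun _ : Fin d => S), f (Fin.cons t p) := by
  rw [← Finset.sum_product']
  refine Finset.sum_nbij' (fun p => (p 0, Fin.tail p)) (fun a => Fin.cons a.1 a.2) ?_ ?_ ?_ ?_ ?_
  · intro p hp
    simp only [Fintype.mem_piFinset, Finset.mem_product, Fin.tail] at hp ⊢
    exact ⟨hp 0, fun i => hp _⟩
  · intro a ha
    simp only [Fintype.mem_piFinset, Finset.mem_product] at ha ⊢
    exact Fin.cases ha.1 ha.2
  · intro p _
    exact Fin.cons_self_tail p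
  · intro a _
    simp
  · intro p _
    simp

lemma cons_add_single_zero {d : ℕ} (t : ℕ) (p : Fin d → ℕ) :
    (Fin.cons t p : Fin (d + 1) → ℕ) + Pi.single 0 1 = Fin.cons (t + 1) p := by
  ext i
  refine Fin.cases ?_ (fun i => ?_) i <;> simp

lemma cons_add_single_succ {d : ℕ} (t : ℕ) (p : Fin d → ℕ) (j : Fin d) :
    (Fin.cons t p : Fin (d + 1) → ℕ) + Pi.single j.succ 1
      = Fin.cons t (p + Pi.single j 1 : Fin d → ℕ) := by
  ext i
  refine Fin.cases ?_ (fun i => ?_) i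
  · simp
  · simp [Pi.single_apply]

/-- Poincaré inequality on a cube with `ℓ` points on a side. -/
lemma poincare_cube (ℓ : ℕ) {d : ℕ} (u : (Fin d → ℕ) → ℂ)
    (hu : ∑ p ∈ Fintype.piFinset (fun _ : Fin d => Finset.range ℓ), u p = 0) :
    ∑ p ∈ Fintype.piFinset (fun _ : Fin d => Finset.range ℓ), ‖u p‖ ^ 2
      ≤ (ℓ : ℝ) ^ 2 * ∑ p ∈ Fintype.piFinset (fun _ : Fin d => Finset.range ℓ),
        ∑ j, ‖u (p + Pi.single j 1) - u p‖ ^ 2 := by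
  rcases Nat.eq_zero_or_pos ℓ with rfl | hℓ
  · rcases d with _ | d
    · simp at hu
      simp [hu]
    · simp
  induction d with
  | zero =>
    simp at hu
    simp [hu]
  | succ d ih =>
    set C := Fintype.piFinset (fun _ : Fin d => Finset.range ℓ)
    let w : (Fin d → ℕ) → ℂ := fun p => ∑ t ∈ Finset.range ℓ, u (Fin.cons t p)
    have hw : ∑ p ∈ C, w p = 0 := by
      rw [← hu, sum_piFinset_cons, Finset.sum_comm]
    have ihw := ih w hw
    simp only [sum_piFinset_cons, Fin.sum_univ_succ, cons_add_single_zero, cons_add_single_succ]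
    have h1 : ∑ p ∈ C, (ℓ * ∑ t ∈ Finset.range ℓ, ‖u (Fin.cons t p)‖ ^ 2) ≤
        ∑ p ∈ C, (‖w p‖ ^ 2 + (ℓ : ℝ) ^ 3 * ∑ t ∈ Finset.range ℓ,
          ‖u (Fin.cons (t + 1) p) - u (Fin.cons t p)‖ ^ 2) :=
      Finset.sum_le_sum fun p _ => poincare_range (fun t => u (Fin.cons t p)) ℓ
    have h2 : ∀ p j, ‖w (p + Pi.single j 1) - w p‖ ^ 2 ≤ ℓ * ∑ t ∈ Finset.range ℓ,
        ‖u (Fin.cons t (p + Pi.single j 1 : Fin d → ℕ)) - u (Fin.cons t p)‖ ^ 2 := by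
      intro p j
      have : ‖w (p + Pi.single j 1) - w p‖ ≤ ∑ t ∈ Finset.range ℓ,
          ‖u (Fin.cons t (p + Pi.single j 1 : Fin d → ℕ)) - u (Fin.cons t p)‖ := by
        simp only [w, ← Finset.sum_sub_distrib]
        exact norm_sum_le _ _
      calc _ ≤ (∑ t ∈ Finset.range ℓ,
          ‖u (Fin.cons t (p + Pi.single j 1 : Fin d → ℕ)) - u (Fin.cons t p)‖) ^ 2 := by gcongr
        _ ≤ _ := sq_sum_le_card_mul_sum_sq
        _ = _ := by rw [Finset.card_range]
    have h3 : ∑ p ∈ C, ∑ j, ‖w (p + Pi.single j 1) - w p‖ ^ 2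
        ≤ ∑ p ∈ C, ∑ j, (ℓ * ∑ t ∈ Finset.range ℓ,
          ‖u (Fin.cons t (p + Pi.single j 1 : Fin d → ℕ)) - u (Fin.cons t p)‖ ^ 2) :=
      Finset.sum_le_sum fun p _ => Finset.sum_le_sum fun j _ => h2 p j
    simp only [Finset.sum_add_distrib, ← Finset.mul_sum] at h1 h3 ⊢
    rw [Finset.sum_comm] at h1
    rw [Finset.sum_comm (s := C) (t := Finset.range ℓ)] at h1
    have e : ∑ p ∈ C, ∑ j, ∑ t ∈ Finset.range ℓ,
          ‖u (Fin.cons t (p + Pi.single j 1 : Fin d → ℕ)) - u (Fin.cons t p)‖ ^ 2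
        = ∑ t ∈ Finset.range ℓ, ∑ p ∈ C, ∑ j,
          ‖u (Fin.cons t (p + Pi.single j 1 : Fin d → ℕ)) - u (Fin.cons t p)‖ ^ 2 := by
      rw [Finset.sum_comm (s := Finset.range ℓ)]
      exact Finset.sum_congr rfl fun p _ => Finset.sum_comm
    rw [e] at h3
    have hℓ' : (0 : ℝ) < ℓ := by exact_mod_cast hℓ
    refine le_of_mul_le_mul_left ?_ hℓ'
    have h4 := mul_le_mul_of_nonneg_left h3 (sq_nonneg (ℓ : ℝ))
    refine h1.trans ((add_le_add_left (ihw.trans h4) _).trans (le_of_eq ?_))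
    ring

end Poincare

section Shells

variable {d : ℕ}

/-- The dyadic box `[-2^k, 2^k)^d`. -/
def dyadicBox (d k : ℕ) : Finset (Fin d → ℤ) :=
  Fintype.piFinset fun _ => Finset.Ico (-2 ^ k) (2 ^ k)

/-- The points of the `k`-th dyadic box outside of the smaller ones. -/
def dyadicShell (d k : ℕ) : Finset (Fin d → ℤ) :=
  (dyadicBox d k).filter fun x => ∀ j < k, x ∉ dyadicBox d j

/-- The point with offset `p` in the dyadic cube of side `2 ^ m` with index `z`. -/
def cubePoint (m : ℕ) (z : Fin d → ℤ) (p : Fin d → ℕ) : Fin d → ℤ := fun i => 2 ^ m * z i + p i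

/-- The sum of a function over the dyadic cube of side `2 ^ m` with index `z`. -/
def cubeSum (m : ℕ) (z : Fin d → ℤ) (u : (Fin d → ℤ) → ℂ) : ℂ :=
  ∑ p ∈ Fintype.piFinset (fun _ : Fin d => Finset.range (2 ^ m)), u (cubePoint m z p)

/-- The index of the dyadic cube of side `2 ^ m` containing `x`. -/
def cubeIndex (m : ℕ) (x : Fin d → ℤ) : Fin d → ℤ := fun i => x i / 2 ^ m

lemma mem_dyadicBox {k : ℕ} {x : Fin d → ℤ} :
    x ∈ dyadicBox d k ↔ ∀ i, -2 ^ k ≤ x i ∧ x i < 2 ^ k := by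
  simp [dyadicBox]

lemma card_dyadicBox (k : ℕ) : (dyadicBox d k).card = (2 * 2 ^ k) ^ d := by
  rw [dyadicBox, Fintype.card_piFinset_const, Int.card_Ico]
  congr 1
  have : ((2 : ℤ) ^ k - -2 ^ k) = ((2 * 2 ^ k : ℕ) : ℤ) := by push_cast; ring
  rw [this, Int.toNat_natCast]

lemma dyadicBox_mono {j k : ℕ} (h : j ≤ k) : dyadicBox d j ⊆ dyadicBox d k := by
  intro x hx
  rw [mem_dyadicBox] at hx ⊢
  have : (2 : ℤ) ^ j ≤ 2 ^ k := pow_le_pow_right₀ (by norm_num) h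
  intro i
  constructor <;> linarith [(hx i).1, (hx i).2]

lemma cubeIndex_mem_dyadicBox {m k : ℕ} (h : m ≤ k) (x : Fin d → ℤ) :
    cubeIndex m x ∈ dyadicBox d (k - m) ↔ x ∈ dyadicBox d k := by
  have hm : (0 : ℤ) < 2 ^ m := by positivity
  have e : (2 : ℤ) ^ k = 2 ^ (k - m) * 2 ^ m := by rw [← pow_add, Nat.sub_add_cancel h]
  simp only [mem_dyadicBox, cubeIndex, Int.le_ediv_iff_mul_le hm, Int.ediv_lt_iff_lt_mul hm, e,
    neg_mul]

lemma exists_mem_dyadicBox (x : Fin d → ℤ) : ∃ k, x ∈ dyadicBox d k := by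
  refine ⟨(∑ i, |x i|).toNat, mem_dyadicBox.mpr fun i => ?_⟩
  have h1 : |x i| ≤ ∑ i, |x i| :=
    Finset.single_le_sum (f := fun i => |x i|) (fun _ _ => abs_nonneg _) (Finset.mem_univ i)
  have h2 : ((∑ i, |x i|).toNat : ℤ) < 2 ^ (∑ i, |x i|).toNat := by
    exact_mod_cast Nat.lt_two_pow_self
  have h3 := Int.self_le_toNat (∑ i, |x i|)
  have h4 := abs_lt.mp (show |x i| < 2 ^ (∑ i, |x i|).toNat by omega)
  exact ⟨h4.1.le, h4.2⟩

lemma exists_mem_dyadicShell (x : Fin d → ℤ) : ∃ k, x ∈ dyadicShell d k := by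
  classical
  refine ⟨Nat.find (exists_mem_dyadicBox x), Finset.mem_filter.mpr
    ⟨Nat.find_spec (exists_mem_dyadicBox x), fun j hj => Nat.find_min _ hj⟩⟩

lemma disjoint_dyadicShell {j k : ℕ} (h : j ≠ k) :
    Disjoint (dyadicShell d j) (dyadicShell d k) := by
  wlog hjk : j < k generalizing j k
  · exact (this h.symm (by omega)).symm
  rw [Finset.disjoint_left]
  intro x hj hk
  exact (Finset.mem_filter.mp hk).2 j hjk (Finset.mem_filter.mp hj).1

lemma mem_dyadicShell_succ {k : ℕ} {x : Fin d → ℤ} :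
    x ∈ dyadicShell d (k + 1) ↔ x ∈ dyadicBox d (k + 1) ∧ x ∉ dyadicBox d k := by
  rw [dyadicShell, Finset.mem_filter]
  refine and_congr_right fun _ => ⟨fun h => h k (by omega), fun h j hj hx => ?_⟩
  exact h (dyadicBox_mono (by omega) hx)

lemma mem_dyadicShell_of_cubeIndex_eq {m k : ℕ} (h : m + 1 ≤ k) {x y : Fin d → ℤ}
    (hxy : cubeIndex m x = cubeIndex m y) (hx : x ∈ dyadicShell d k) : y ∈ dyadicShell d k := by
  obtain ⟨k, rfl⟩ : ∃ k', k = k' + 1 := ⟨k - 1, by omega⟩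
  rw [mem_dyadicShell_succ] at hx ⊢
  rw [← cubeIndex_mem_dyadicBox (by omega : m ≤ k + 1),
    ← cubeIndex_mem_dyadicBox (by omega : m ≤ k)] at hx ⊢
  rwa [← hxy]

lemma cubeIndex_cubePoint {m : ℕ} (z : Fin d → ℤ) {p : Fin d → ℕ}
    (hp : p ∈ Fintype.piFinset (fun _ : Fin d => Finset.range (2 ^ m))) :
    cubeIndex m (cubePoint m z p) = z := by
  ext i
  simp only [Fintype.mem_piFinset, Finset.mem_range] at hp
  have h1 : (p i : ℤ) < 2 ^ m := by exact_mod_cast hp i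
  simp only [cubeIndex, cubePoint]
  rw [Int.mul_add_ediv_left _ _ (by positivity), Int.ediv_eq_zero_of_lt (by positivity) h1,
    add_zero]

lemma cubePoint_cubeIndex (m : ℕ) (x : Fin d → ℤ) :
    cubePoint m (cubeIndex m x) (fun i => (x i % 2 ^ m).toNat) = x := by
  ext i
  simp only [cubeIndex, cubePoint]
  rw [Int.toNat_of_nonneg (Int.emod_nonneg _ (by positivity))]
  exact Int.mul_ediv_add_emod _ _

/-- Sums over a cube-saturated set split into sums over dyadic cubes. -/
lemma sum_eq_sum_cubes {M : Type*} [AddCommMonoid M] (m : ℕ) (T : Finset (Fin d → ℤ))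
    (hT : ∀ x y, cubeIndex m x = cubeIndex m y → x ∈ T → y ∈ T) (f : (Fin d → ℤ) → M) :
    ∑ x ∈ T, f x = ∑ z ∈ T.image (cubeIndex m),
      ∑ p ∈ Fintype.piFinset (fun _ : Fin d => Finset.range (2 ^ m)), f (cubePoint m z p) := by
  rw [← Finset.sum_fiberwise_of_maps_to (g := cubeIndex m) (t := T.image (cubeIndex m))
    fun x hx => Finset.mem_image_of_mem _ hx]
  refine Finset.sum_congr rfl fun z hz => ?_
  obtain ⟨x₀, hx₀, rfl⟩ := Finset.mem_image.mp hz
  refine Finset.sum_nbij' (fun x i => (x i % 2 ^ m).toNat) (cubePoint m (cubeIndex m x₀))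
    ?_ ?_ ?_ ?_ ?_
  · intro x _
    simp only [Fintype.mem_piFinset, Finset.mem_range]
    intro i
    have h1 := Int.emod_lt_of_pos (x i) (show (0 : ℤ) < 2 ^ m by positivity)
    have h2 := Int.emod_nonneg (x i) (show (2 : ℤ) ^ m ≠ 0 by positivity)
    zify
    rwa [Int.toNat_of_nonneg h2]
  · intro p hp
    have h := cubeIndex_cubePoint (cubeIndex m x₀) hp
    exact Finset.mem_filter.mpr ⟨hT _ _ h.symm hx₀, h⟩
  · intro x hx
    rw [← (Finset.mem_filter.mp hx).2, cubePoint_cubeIndex]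
  · intro p hp
    ext i
    have h1 : (p i : ℤ) < 2 ^ m := by
      simp only [Fintype.mem_piFinset, Finset.mem_range] at hp
      exact_mod_cast hp i
    simp only [cubePoint]
    rw [Int.mul_add_emod_self_left, Int.emod_eq_of_lt (by positivity) h1, Int.toNat_natCast]
  · intro x hx
    rw [← (Finset.mem_filter.mp hx).2, cubePoint_cubeIndex]

lemma cubePoint_add_single (m : ℕ) (z : Fin d → ℤ) (p : Fin d → ℕ) (j : Fin d) :
    cubePoint m z (p + Pi.single j 1) = cubePoint m z p + latUnit d j := by
  ext i
  simp only [cubePoint, latUnit, Pi.add_apply, Pi.single_apply]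
  split_ifs <;> push_cast <;> ring

/-- Poincaré inequality on a cube-saturated set for functions with vanishing cube averages. -/
lemma poincare_saturated (m : ℕ) (T : Finset (Fin d → ℤ))
    (hT : ∀ x y, cubeIndex m x = cubeIndex m y → x ∈ T → y ∈ T) (u : (Fin d → ℤ) → ℂ)
    (hu : ∀ x ∈ T, cubeSum m (cubeIndex m x) u = 0) :
    ∑ x ∈ T, ‖u x‖ ^ 2 ≤ 4 ^ m * ∑ x ∈ T, gradSq u x := by
  rw [sum_eq_sum_cubes m T hT, sum_eq_sum_cubes m T hT, Finset.mul_sum]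
  refine Finset.sum_le_sum fun z hz => ?_
  obtain ⟨x₀, hx₀, rfl⟩ := Finset.mem_image.mp hz
  have h := poincare_cube (2 ^ m) (fun p => u (cubePoint m (cubeIndex m x₀) p)) (hu x₀ hx₀)
  simp only [cubePoint_add_single] at h
  refine h.trans (le_of_eq ?_)
  congr 1
  push_cast
  rw [← pow_mul, mul_comm, pow_mul]
  norm_num

lemma eq_zero_of_cubeSum_zero {x : Fin d → ℤ} {u : (Fin d → ℤ) → ℂ}
    (h : cubeSum 0 (cubeIndex 0 x) u = 0) : u x = 0 := by
  have h0 : Fintype.piFinset (fun _ : Fin d => Finset.range (2 ^ 0)) = {0} := by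
    ext p
    simp [funext_iff]
  rw [cubeSum, h0, Finset.sum_singleton] at h
  convert h
  ext i
  simp [cubePoint, cubeIndex]

lemma sum_dyadicShell_le_tsum {g : (Fin d → ℤ) → ℝ} (hg : ∀ x, 0 ≤ g x) (hs : Summable g) (N : ℕ) :
    ∑ k ∈ Finset.range N, ∑ x ∈ dyadicShell d k, g x ≤ ∑' x, g x := by
  rw [← Finset.sum_biUnion fun j _ k _ h => disjoint_dyadicShell h]
  exact hs.sum_le_tsum _ fun x _ => hg x

/-- Counting bound from dyadic shells: near shells are cut into cubes, and the far region
is controlled by the Hardy inequality. -/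
lemma nCount_le_of_shells (hd : 3 ≤ d) {V : (Fin d → ℤ) → ℝ} (hV : ∀ x, 0 ≤ V x) {s : ℝ}
    (hs : 0 ≤ s) (N : ℕ) (n : ℕ → ℕ) (A : ℕ → ℝ) (hn : ∀ k < N, 1 ≤ n k)
    (hA : ∀ k < N, ∀ x ∈ dyadicShell d k, V x ≤ A k)
    (hnA : ∀ k < N, A k * 4 ^ k ≤ 4 ^ n k * (s / 2)) (hA0 : ∀ k < N, 0 ≤ A k)
    (hfar : ∀ k, N ≤ k → ∀ x ∈ dyadicShell d k, 16 * (V x * (normSqZ x + 12)) ≤ s) :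
    nCount d V s ≤ (∑ k ∈ Finset.range N, (2 * 2 ^ n k) ^ d : ℕ) := by
  refine iSup_le ?_
  rintro ⟨L, hfin, hfd, hadm⟩
  simp only [Nat.cast_le]
  by_contra! hlt
  let I := (Finset.range N).sigma fun k => dyadicBox d (n k)
  let Φ : L →ₗ[ℂ] (I → ℂ) :=
    { toFun := fun u i => cubeSum (i.1.1 - n i.1.1) i.1.2 u.1
      map_add' := fun u v => by
        ext i
        simp [cubeSum, Finset.sum_add_distrib]
      map_smul' := fun c u => by
        ext i
        simp [cubeSum, Finset.mul_sum] }
  have hker : LinearMap.ker Φ ≠ ⊥ := by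
    refine LinearMap.ker_ne_bot_of_finrank_lt ?_
    rw [Module.finrank_fintype_fun_eq_card, Fintype.card_coe, Finset.card_sigma]
    simpa only [card_dyadicBox] using hlt
  obtain ⟨⟨u, huL⟩, hu0, hune⟩ := (Submodule.ne_bot_iff _).mp hker
  have hune' : u ≠ 0 := fun h => hune (Subtype.ext h)
  have husupp := hfin u huL
  have hcube : ∀ k < N, ∀ x ∈ dyadicShell d k, cubeSum (k - n k) (cubeIndex (k - n k) x) u = 0 := by
    intro k hk x hx
    have hz : cubeIndex (k - n k) x ∈ dyadicBox d (n k) := by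
      have := (cubeIndex_mem_dyadicBox (Nat.sub_le k (n k)) x).mpr (Finset.mem_filter.mp hx).1
      exact dyadicBox_mono (by omega) this
    exact congrFun hu0 ⟨⟨k, cubeIndex (k - n k) x⟩,
      Finset.mem_sigma.mpr ⟨Finset.mem_range.mpr hk, hz⟩⟩
  have hnear : ∀ k < N, ∑ x ∈ dyadicShell d k, V x * ‖u x‖ ^ 2
      ≤ s / 2 * ∑ x ∈ dyadicShell d k, gradSq u x := by
    intro k hk
    rcases Nat.lt_or_ge k (n k) with h | h
    · have h0 : ∑ x ∈ dyadicShell d k, V x * ‖u x‖ ^ 2 = 0 := by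
        refine Finset.sum_eq_zero fun x hx => ?_
        have := hcube k hk x hx
        rw [Nat.sub_eq_zero_of_le h.le] at this
        simp [eq_zero_of_cubeSum_zero this]
      rw [h0]
      exact mul_nonneg (by positivity) (Finset.sum_nonneg fun _ _ => gradSq_nonneg _ _)
    · have hP := poincare_saturated (k - n k) (dyadicShell d k)
        (fun x y hxy => mem_dyadicShell_of_cubeIndex_eq (by have := hn k hk; omega) hxy) u
        (hcube k hk)
      have hG : 0 ≤ ∑ x ∈ dyadicShell d k, gradSq u x :=
        Finset.sum_nonneg fun _ _ => gradSq_nonneg _ _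
      have hA4 : A k * 4 ^ (k - n k) ≤ s / 2 := by
        have h1 := hnA k hk
        have h2 : (4 : ℝ) ^ k = 4 ^ (k - n k) * 4 ^ n k := by
          rw [← pow_add, Nat.sub_add_cancel h]
        rw [h2, ← mul_assoc, mul_comm (4 ^ n k) (s / 2)] at h1
        exact le_of_mul_le_mul_right h1 (by positivity)
      calc ∑ x ∈ dyadicShell d k, V x * ‖u x‖ ^ 2
          ≤ ∑ x ∈ dyadicShell d k, A k * ‖u x‖ ^ 2 :=
            Finset.sum_le_sum fun x hx => by
              have := hA k hk x hx
              gcongr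
        _ = A k * ∑ x ∈ dyadicShell d k, ‖u x‖ ^ 2 := by rw [Finset.mul_sum]
        _ ≤ A k * (4 ^ (k - n k) * ∑ x ∈ dyadicShell d k, gradSq u x) :=
            mul_le_mul_of_nonneg_left hP (hA0 k hk)
        _ = A k * 4 ^ (k - n k) * ∑ x ∈ dyadicShell d k, gradSq u x := by ring
        _ ≤ _ := mul_le_mul_of_nonneg_right hA4 hG
  let S := (Finset.range N).biUnion fun k => dyadicShell d k
  have hpt : ∀ x, V x * ‖u x‖ ^ 2 ≤ (if x ∈ S then V x * ‖u x‖ ^ 2 else 0)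
      + s / 16 * (1 / (normSqZ x + 12) * ‖u x‖ ^ 2) := by
    intro x
    have hx0 := normSqZ_nonneg x
    have h0 : 0 ≤ s / 16 * (1 / (normSqZ x + 12) * ‖u x‖ ^ 2) := by positivity
    split_ifs with hx
    · linarith
    · obtain ⟨k, hk⟩ := exists_mem_dyadicShell x
      have hkN : N ≤ k := by
        by_contra! hlt
        exact hx (Finset.mem_biUnion.mpr ⟨k, Finset.mem_range.mpr hlt, hk⟩)
      have h1 := hfar k hkN x hk
      have h2 : V x ≤ s / 16 * (1 / (normSqZ x + 12)) := by
        rw [mul_one_div, le_div_iff₀ (by positivity)]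
        linarith
      rw [zero_add, ← mul_assoc]
      gcongr
  have hfinS : Summable fun x => if x ∈ S then V x * ‖u x‖ ^ 2 else 0 :=
    summable_of_hasFiniteSupport (S.finite_toSet.subset fun x hx => by
      contrapose! hx
      simp_all)
  have hH := summable_of_finite_support_mul husupp fun x => 1 / (normSqZ x + 12)
  have htot : ∑' x, V x * ‖u x‖ ^ 2 ≤ s * ∑' x, gradSq u x := by
    have h1 : ∑' x, V x * ‖u x‖ ^ 2 ≤ ∑' x, ((if x ∈ S then V x * ‖u x‖ ^ 2 else 0)
        + s / 16 * (1 / (normSqZ x + 12) * ‖u x‖ ^ 2)) :=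
      Summable.tsum_le_tsum hpt (summable_of_finite_support_mul husupp V)
        (hfinS.add (hH.mul_left _))
    rw [hfinS.tsum_add (hH.mul_left _), tsum_mul_left] at h1
    have h2 : ∑' x, (if x ∈ S then V x * ‖u x‖ ^ 2 else 0) ≤ s / 2 * ∑' x, gradSq u x := by
      rw [tsum_eq_sum (s := S) fun x hx => if_neg hx, Finset.sum_congr rfl fun x hx => if_pos hx,
        Finset.sum_biUnion fun j _ k _ h => disjoint_dyadicShell h]
      calc _ ≤ ∑ k ∈ Finset.range N, s / 2 * ∑ x ∈ dyadicShell d k, gradSq u x :=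
            Finset.sum_le_sum fun k hk => hnear k (Finset.mem_range.mp hk)
        _ = s / 2 * ∑ k ∈ Finset.range N, ∑ x ∈ dyadicShell d k, gradSq u x := by
            rw [Finset.mul_sum]
        _ ≤ _ := mul_le_mul_of_nonneg_left
            (sum_dyadicShell_le_tsum (gradSq_nonneg u) (summable_gradSq husupp) N) (by positivity)
    have h3 := mul_le_mul_of_nonneg_left (hardy hd husupp) (show 0 ≤ s / 16 by positivity)
    linarith
  have hstrict := hadm u huL hune'
  rw [Q0_eq_ofReal husupp, bV_eq_ofReal husupp hV, ← ENNReal.ofReal_mul hs] at hstrict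
  exact absurd (ENNReal.ofReal_le_ofReal htot) (not_le.mpr hstrict)

end Shells

section UpperBound

variable {d : ℕ}

lemma sum_rpow_neg_le {σ : ℝ} (h0 : 0 ≤ σ) (h1 : σ < 1) (N : ℕ) :
    ∑ k ∈ Finset.range N, ((k : ℝ) + 1) ^ (-σ) ≤ (N : ℝ) ^ (1 - σ) / (1 - σ) := by
  induction N with
  | zero => simp [Real.zero_rpow (by linarith : (1 - σ) ≠ 0)]
  | succ N ih =>
    rw [Finset.sum_range_succ]
    have hs : 0 < 1 - σ := by linarith
    have hN : (0 : ℝ) < (N : ℝ) + 1 := by positivity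
    have hb := rpow_one_add_le_one_add_mul_self (s := -(1 / ((N : ℝ) + 1)))
      (by rw [neg_le_neg_iff, div_le_one hN]; linarith [Nat.cast_nonneg (α := ℝ) N])
      hs.le (by linarith)
    have e1 : 1 + -(1 / ((N : ℝ) + 1)) = N / (N + 1) := by field_simp; ring
    rw [e1, Real.div_rpow (Nat.cast_nonneg N) hN.le, div_le_iff₀ (by positivity)] at hb
    have e2 : ((N : ℝ) + 1) ^ (1 - σ) = (N + 1) * (N + 1) ^ (-σ) := by
      rw [sub_eq_add_neg, Real.rpow_add hN, Real.rpow_one]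
    have e3 : (1 + (1 - σ) * -(1 / ((N : ℝ) + 1))) * ((N : ℝ) + 1) ^ (1 - σ)
        = ((N : ℝ) + 1) ^ (1 - σ) - (1 - σ) * (N + 1) ^ (-σ) := by
      rw [e2]
      field_simp
      ring
    rw [e3] at hb
    push_cast
    rw [le_div_iff₀ hs] at ih ⊢
    linarith

lemma two_le_normSqZ {x : Fin d → ℤ} (hx : 1 < znorm x) : 2 ≤ normSqZ x := by
  have h1 : 1 < normSqZ x := by
    rw [← znorm_sq]
    nlinarith
  have e : normSqZ x = ((∑ i, x i ^ 2 : ℤ) : ℝ) := by simp [normSqZ]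
  rw [e] at h1 ⊢
  have h2 : 1 < ∑ i, x i ^ 2 := by exact_mod_cast h1
  exact_mod_cast (show (2 : ℤ) ≤ ∑ i, x i ^ 2 by omega)

lemma four_pow_le_of_mem_dyadicShell_succ {k : ℕ} {x : Fin d → ℤ}
    (hx : x ∈ dyadicShell d (k + 1)) : (4 : ℝ) ^ k ≤ normSqZ x := by
  have h := (mem_dyadicShell_succ.mp hx).2
  rw [mem_dyadicBox] at h
  push Not at h
  obtain ⟨i, hi⟩ := h
  have h2 : (2 : ℤ) ^ k ≤ |x i| := by
    by_cases h3 : -2 ^ k ≤ x i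
    · exact (hi h3).trans (le_abs_self _)
    · exact le_trans (by linarith) (neg_le_abs _)
  have h3 : (2 : ℝ) ^ k ≤ |(x i : ℝ)| := by exact_mod_cast h2
  calc (4 : ℝ) ^ k = (2 ^ k) ^ 2 := by rw [← pow_mul, mul_comm, pow_mul]; norm_num
    _ ≤ |(x i : ℝ)| ^ 2 := by gcongr
    _ = (x i : ℝ) ^ 2 := sq_abs _
    _ ≤ _ := sq_le_normSqZ x i

lemma log_znorm_ge_of_mem_dyadicShell {k : ℕ} {x : Fin d → ℤ} (hx : x ∈ dyadicShell d k)
    (h1 : 1 < znorm x) : ((k : ℝ) + 1) / 8 ≤ Real.log (znorm x) := by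
  have h2 := two_le_normSqZ h1
  have e : Real.log (znorm x) = Real.log (normSqZ x) / 2 := Real.log_sqrt (normSqZ_nonneg x)
  have hlog2 := Real.log_two_gt_d9
  have h3 : Real.log 2 ≤ Real.log (normSqZ x) := Real.log_le_log (by norm_num) h2
  rw [e]
  rcases k with _ | k
  · simp only [Nat.cast_zero]
    linarith
  · have h4 : Real.log (4 ^ k) ≤ Real.log (normSqZ x) :=
      Real.log_le_log (by positivity) (four_pow_le_of_mem_dyadicShell_succ hx)
    have e4 : Real.log 4 = 2 * Real.log 2 := by
      rw [show (4 : ℝ) = 2 ^ 2 by norm_num, Real.log_pow]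
      norm_num
    rw [Real.log_pow, e4] at h4
    push_cast
    rcases k with _ | k
    · simp only [Nat.cast_zero]
      linarith
    · push_cast at h4 ⊢
      have hk : (0 : ℝ) ≤ k := Nat.cast_nonneg k
      nlinarith

lemma four_pow_le_of_mem_dyadicShell {k : ℕ} {x : Fin d → ℤ} (hx : x ∈ dyadicShell d k)
    (h1 : 1 < znorm x) : (4 : ℝ) ^ k ≤ 4 * normSqZ x := by
  rcases k with _ | k
  · have := two_le_normSqZ h1
    simp only [pow_zero]
    linarith
  · have := four_pow_le_of_mem_dyadicShell_succ hx
    rw [pow_succ]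
    linarith

lemma exPot_eq {q : ℝ} {x : Fin d → ℤ} (h1 : 1 < znorm x) :
    exPot d q x = (normSqZ x)⁻¹ * Real.log (znorm x) ^ (-(1 / q)) := by
  rw [exPot, if_pos h1, Real.rpow_neg (by linarith), Real.rpow_two, znorm_sq]

lemma exPot_mul_normSqZ_le {q : ℝ} (hq : 1 ≤ q) {k : ℕ} {x : Fin d → ℤ}
    (hx : x ∈ dyadicShell d k) (h1 : 1 < znorm x) :
    exPot d q x * normSqZ x ≤ 8 * ((k : ℝ) + 1) ^ (-(1 / q)) := by
  have h2 := two_le_normSqZ h1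
  have h3 := log_znorm_ge_of_mem_dyadicShell hx h1
  have hq0 : 0 < 1 / q := by positivity
  have hk : (0 : ℝ) < (k : ℝ) + 1 := by positivity
  rw [exPot_eq h1]
  calc (normSqZ x)⁻¹ * Real.log (znorm x) ^ (-(1 / q)) * normSqZ x
      = Real.log (znorm x) ^ (-(1 / q)) := by field_simp
    _ ≤ (((k : ℝ) + 1) / 8) ^ (-(1 / q)) :=
        Real.rpow_le_rpow_of_nonpos (by positivity) h3 (by linarith)
    _ = (8 : ℝ) ^ (1 / q) * ((k : ℝ) + 1) ^ (-(1 / q)) := by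
        rw [Real.div_rpow hk.le (by norm_num), Real.rpow_neg (by norm_num : (0 : ℝ) ≤ 8)]
        field_simp
    _ ≤ 8 * ((k : ℝ) + 1) ^ (-(1 / q)) := by
        gcongr
        calc (8 : ℝ) ^ (1 / q) ≤ 8 ^ (1 : ℝ) :=
              Real.rpow_le_rpow_of_exponent_le (by norm_num) (by rw [div_le_one (by linarith)]; exact hq)
          _ = 8 := Real.rpow_one _

lemma exPot_upper (hd : 3 ≤ d) {q : ℝ} (hq : (d : ℝ) < 2 * q) {s : ℝ} (hs : 0 < s) :
    ENNReal.ofReal (s ^ q) * (nCount d (exPot d q) s : ℝ≥0∞)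
      ≤ ENNReal.ofReal (16 ^ ((d : ℝ) / 2) * 896 ^ q / (1 - d / (2 * q))) := by
  have hd' : (3 : ℝ) ≤ d := by exact_mod_cast hd
  have hq1 : 1 ≤ q := by linarith
  have hq0 : 0 < q := by linarith
  set σ : ℝ := d / (2 * q) with hσ
  have hσ0 : 0 ≤ σ := by positivity
  have hσ1 : σ < 1 := by rw [hσ, div_lt_one (by positivity)]; exact hq
  set X : ℝ := (896 / s) ^ q with hX
  have hX0 : 0 < X := by positivity
  have hXq : X ^ (1 / q) = 896 / s := by
    rw [hX, ← Real.rpow_mul (by positivity), mul_one_div_cancel hq0.ne', Real.rpow_one]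
  let b : ℕ → ℝ := fun k => ((k : ℝ) + 1) ^ (-(1 / q))
  have hb0 : ∀ k, 0 < b k := fun k => by positivity
  have hY : ∀ k : ℕ, 896 * b k / s = (X / (k + 1)) ^ (1 / q) := by
    intro k
    rw [Real.div_rpow hX0.le (by positivity), hXq]
    simp only [b]
    rw [Real.rpow_neg (by positivity)]
    field_simp
  have hchoice : ∀ k : ℕ, ∃ n : ℕ, k < ⌊X⌋₊ →
      1 ≤ n ∧ 896 * b k / s ≤ 4 ^ n ∧ (4 : ℝ) ^ n ≤ 4 * (896 * b k / s) := by
    intro k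
    by_cases hk : k < ⌊X⌋₊
    · have h1 : (k : ℝ) + 1 ≤ X := by
        have := (Nat.le_floor_iff hX0.le).mp (Nat.succ_le_of_lt hk)
        exact_mod_cast this
      have h2 : 1 ≤ 896 * b k / s := by
        rw [hY]
        exact Real.one_le_rpow ((one_le_div (by positivity)).mpr h1) (by positivity)
      obtain ⟨n, hn1, hn2⟩ := exists_nat_pow_near h2 (show (1 : ℝ) < 4 by norm_num)
      refine ⟨n + 1, fun _ => ⟨by omega, hn2.le, ?_⟩⟩
      rw [pow_succ]
      linarith
    · exact ⟨0, fun h => absurd h hk⟩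
  choose n hn using hchoice
  have hcount := nCount_le_of_shells hd (exPot_nonneg (d := d) q) hs.le ⌊X⌋₊ n
    (fun k => 32 * b k / 4 ^ k) (fun k hk => (hn k hk).1) ?_ ?_ (fun k _ => by have := hb0 k; positivity)
    ?_
  rotate_left
  · intro k _ x hx
    have hbk := hb0 k
    by_cases h1 : 1 < znorm x
    · have h2 := exPot_mul_normSqZ_le hq1 hx h1
      have h3 := four_pow_le_of_mem_dyadicShell hx h1
      have h4 := exPot_nonneg q x
      change exPot d q x * normSqZ x ≤ 8 * b k at h2
      rw [le_div_iff₀ (by positivity)]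
      nlinarith
    · rw [exPot, if_neg h1]
      positivity
  · intro k hk
    have h2 := (hn k hk).2.1
    have hbk := hb0 k
    rw [div_le_iff₀ hs] at h2
    rw [div_mul_cancel₀ _ (by positivity)]
    linarith
  · intro k hk x hx
    by_cases h1 : 1 < znorm x
    · have h2 := exPot_mul_normSqZ_le hq1 hx h1
      change exPot d q x * normSqZ x ≤ 8 * b k at h2
      have h3 := two_le_normSqZ h1
      have h4 := exPot_nonneg q x
      have h5 : X ≤ (k : ℝ) + 1 := by
        have := Nat.lt_floor_add_one X
        have hk' : ((⌊X⌋₊ : ℕ) : ℝ) ≤ k := by exact_mod_cast hk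
        linarith
      have h6 : 896 * b k / s ≤ 1 := by
        rw [hY]
        exact Real.rpow_le_one (by positivity) ((div_le_one (by positivity)).mpr h5) (by positivity)
      rw [div_le_one hs] at h6
      nlinarith
    · rw [exPot, if_neg h1]
      linarith
  have hterm : ∀ k < ⌊X⌋₊, ((2 * 2 ^ n k) ^ d : ℝ)
      ≤ 16 ^ ((d : ℝ) / 2) * (X ^ σ * ((k : ℝ) + 1) ^ (-σ)) := by
    intro k hk
    have h1 := (hn k hk).2.2
    have h2 : ((2 * 2 ^ n k) ^ d : ℝ) = (4 * 4 ^ n k) ^ ((d : ℝ) / 2) := by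
      have : (4 * 4 ^ n k : ℝ) = (2 * 2 ^ n k) ^ (2 : ℝ) := by
        rw [Real.rpow_two, mul_pow, ← pow_mul, mul_comm (n k), pow_mul]
        norm_num
      rw [this, ← Real.rpow_mul (by positivity), mul_div_cancel₀ _ (by norm_num : (2 : ℝ) ≠ 0),
        Real.rpow_natCast]
    have hY0 : 0 < 896 * b k / s := by have := hb0 k; positivity
    rw [h2]
    calc (4 * 4 ^ n k : ℝ) ^ ((d : ℝ) / 2) ≤ (16 * (896 * b k / s)) ^ ((d : ℝ) / 2) := by
          refine Real.rpow_le_rpow (by positivity) ?_ (by positivity)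
          linarith
      _ = 16 ^ ((d : ℝ) / 2) * (X / (k + 1)) ^ σ := by
          rw [Real.mul_rpow (by norm_num) hY0.le, hY, ← Real.rpow_mul (by positivity)]
          congr 2
          rw [hσ]
          field_simp
      _ = _ := by
          rw [Real.div_rpow hX0.le (by positivity), Real.rpow_neg (by positivity),
            div_eq_mul_inv (X ^ σ)]
  have hsum : ((∑ k ∈ Finset.range ⌊X⌋₊, (2 * 2 ^ n k) ^ d : ℕ) : ℝ)
      ≤ 16 ^ ((d : ℝ) / 2) * X / (1 - σ) := by
    push_cast
    calc ∑ k ∈ Finset.range ⌊X⌋₊, ((2 * 2 ^ n k) ^ d : ℝ)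
        ≤ ∑ k ∈ Finset.range ⌊X⌋₊, 16 ^ ((d : ℝ) / 2) * (X ^ σ * ((k : ℝ) + 1) ^ (-σ)) :=
          Finset.sum_le_sum fun k hk => hterm k (Finset.mem_range.mp hk)
      _ = 16 ^ ((d : ℝ) / 2) * (X ^ σ * ∑ k ∈ Finset.range ⌊X⌋₊, ((k : ℝ) + 1) ^ (-σ)) := by
          rw [Finset.mul_sum, Finset.mul_sum]
      _ ≤ 16 ^ ((d : ℝ) / 2) * (X ^ σ * (X ^ (1 - σ) / (1 - σ))) := by
          have h1 : (0 : ℝ) < 1 - σ := by linarith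
          have h2 : ((⌊X⌋₊ : ℕ) : ℝ) ^ (1 - σ) ≤ X ^ (1 - σ) :=
            Real.rpow_le_rpow (Nat.cast_nonneg _) (Nat.floor_le hX0.le) h1.le
          have h3 := (sum_rpow_neg_le hσ0 hσ1 ⌊X⌋₊).trans (div_le_div_of_nonneg_right h2 h1.le)
          gcongr
      _ = _ := by
          rw [← mul_div_assoc (X ^ σ), ← Real.rpow_add hX0, add_sub_cancel, Real.rpow_one,
            mul_div_assoc]
  set M : ℕ := ∑ k ∈ Finset.range ⌊X⌋₊, (2 * 2 ^ n k) ^ d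
  have hcount' : (nCount d (exPot d q) s : ℝ≥0∞) ≤ ENNReal.ofReal (M : ℝ) := by
    rw [ENNReal.ofReal_natCast]
    calc (nCount d (exPot d q) s : ℝ≥0∞) ≤ ((M : ℕ∞) : ℝ≥0∞) := ENat.toENNReal_le.mpr hcount
      _ = M := ENat.toENNReal_coe M
  refine (mul_le_mul_right hcount' _).trans ?_
  rw [← ENNReal.ofReal_mul (by positivity)]
  refine ENNReal.ofReal_le_ofReal ?_
  have hsX : s ^ q * X = 896 ^ q := by
    rw [hX, ← Real.mul_rpow hs.le (by positivity), mul_div_cancel₀ _ hs.ne']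
  calc s ^ q * M ≤ s ^ q * (16 ^ ((d : ℝ) / 2) * X / (1 - σ)) := by gcongr
    _ = 16 ^ ((d : ℝ) / 2) * (s ^ q * X) / (1 - σ) := by ring
    _ = _ := by rw [hsX]

end UpperBound

section LowerBound

variable {d : ℕ}

lemma norm_sum_mul_sq_of_disjoint {ι : Type*} [Fintype ι] (c a : ι → ℂ)
    (ha : ∀ k l, k ≠ l → a k = 0 ∨ a l = 0) :
    ‖∑ k, c k * a k‖ ^ 2 = ∑ k, ‖c k‖ ^ 2 * ‖a k‖ ^ 2 := by
  by_cases h : ∃ k, a k ≠ 0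
  · obtain ⟨k, hk⟩ := h
    have h0 : ∀ l, l ≠ k → a l = 0 := fun l hl => (ha k l hl.symm).resolve_left hk
    rw [Finset.sum_eq_single k (fun l _ hl => by simp [h0 l hl]) (by simp),
      Finset.sum_eq_single k (fun l _ hl => by simp [h0 l hl]) (by simp), norm_mul, mul_pow]
  · push Not at h
    simp [h]

/-- Non-adjacent test functions, each of them admissible, give a lower bound for the counting
function. -/
lemma le_nCount_of_disjoint {V : (Fin d → ℤ) → ℝ} (hV : ∀ x, 0 ≤ V x) {s : ℝ} (hs : 0 ≤ s)
    {N : ℕ} (v : Fin N → (Fin d → ℤ) → ℂ) (hfin : ∀ k, (Function.support (v k)).Finite)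
    (hval : ∀ x k l, k ≠ l → v k x = 0 ∨ v l x = 0)
    (hgrad : ∀ x j k l, k ≠ l →
      v k (x + latUnit d j) - v k x = 0 ∨ v l (x + latUnit d j) - v l x = 0)
    (hlt : ∀ k, s * ∑' x, gradSq (v k) x < ∑' x, V x * ‖v k x‖ ^ 2) :
    (N : ℕ∞) ≤ nCount d V s := by
  let Φ : (Fin N → ℂ) →ₗ[ℂ] ((Fin d → ℤ) → ℂ) := Fintype.linearCombination ℂ v
  have hΦ : ∀ c x, Φ c x = ∑ k, c k * v k x := fun c x => by
    simp [Φ, Fintype.linearCombination_apply, Finset.sum_apply]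
  have hΦfin : ∀ c, (Function.support (Φ c)).Finite := fun c => by
    refine (Set.finite_iUnion hfin).subset fun x hx => ?_
    by_contra hx'
    simp only [Set.mem_iUnion, Function.mem_support, not_exists, not_not] at hx'
    exact hx (by simp [hΦ, hx'])
  have hval' : ∀ c x, ‖Φ c x‖ ^ 2 = ∑ k, ‖c k‖ ^ 2 * ‖v k x‖ ^ 2 := fun c x => by
    rw [hΦ, norm_sum_mul_sq_of_disjoint _ _ (hval x)]
  have hgrad' : ∀ c x, gradSq (Φ c) x = ∑ k, ‖c k‖ ^ 2 * gradSq (v k) x := fun c x => by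
    simp only [gradSq, Finset.mul_sum]
    rw [Finset.sum_comm]
    refine Finset.sum_congr rfl fun j _ => ?_
    rw [hΦ, hΦ, ← Finset.sum_sub_distrib]
    simp only [← mul_sub]
    exact norm_sum_mul_sq_of_disjoint _ _ (hgrad x j)
  have hQ : ∀ c, ∑' x, gradSq (Φ c) x = ∑ k, ‖c k‖ ^ 2 * ∑' x, gradSq (v k) x := fun c => by
    simp only [hgrad', ← tsum_mul_left]
    exact Summable.tsum_finsetSum fun k _ => (summable_gradSq (hfin k)).mul_left _
  have hB : ∀ c, ∑' x, V x * ‖Φ c x‖ ^ 2 = ∑ k, ‖c k‖ ^ 2 * ∑' x, V x * ‖v k x‖ ^ 2 := fun c => by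
    simp only [hval', ← tsum_mul_left, Finset.mul_sum, mul_left_comm (V _)]
    exact Summable.tsum_finsetSum fun k _ =>
      (summable_of_finite_support_mul (hfin k) V).mul_left _
  have hadm : ∀ c, c ≠ 0 → ENNReal.ofReal s * Q0 (Φ c) < bV V (Φ c) := by
    intro c hc
    obtain ⟨k, hk⟩ := Function.ne_iff.mp hc
    have hk' : c k ≠ 0 := hk
    have hreal : s * ∑' x, gradSq (Φ c) x < ∑' x, V x * ‖Φ c x‖ ^ 2 := by
      rw [hQ, hB, Finset.mul_sum]
      refine Finset.sum_lt_sum (fun l _ => ?_) ⟨k, Finset.mem_univ k, ?_⟩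
      · rw [mul_left_comm]
        exact mul_le_mul_of_nonneg_left (hlt l).le (by positivity)
      · rw [mul_left_comm]
        exact mul_lt_mul_of_pos_left (hlt k) (by positivity)
    rw [Q0_eq_ofReal (hΦfin c), bV_eq_ofReal (hΦfin c) hV, ← ENNReal.ofReal_mul hs]
    refine (ENNReal.ofReal_lt_ofReal_iff (lt_of_le_of_lt ?_ hreal)).mpr hreal
    exact mul_nonneg hs (tsum_nonneg fun x => gradSq_nonneg _ x)
  have hinj : Function.Injective Φ := by
    rw [← LinearMap.ker_eq_bot, LinearMap.ker_eq_bot']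
    intro c hc
    by_contra hne
    have := hadm c hne
    rw [hc] at this
    simp [bV] at this
  refine le_iSup_of_le ⟨LinearMap.range Φ, ?_, inferInstance, ?_⟩ ?_
  · rintro _ ⟨c, rfl⟩
    exact hΦfin c
  · rintro _ ⟨c, rfl⟩ hne
    exact hadm c fun h => hne (by simp [h])
  · simp only
    rw [LinearMap.finrank_range_of_inj hinj, Module.finrank_fin_fun]

/-- A tent function of the sup norm, living on the annulus `2r < ‖x‖ < 6r`. -/
def annularTent {d : ℕ} (r : ℝ) (x : Fin d → ℤ) : ℝ := max 0 (2 * r - |‖x‖ - 4 * r|)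

lemma annularTent_eq_zero {r : ℝ} {x : Fin d → ℤ} (h : ‖x‖ ≤ 2 * r ∨ 6 * r ≤ ‖x‖) :
    annularTent r x = 0 := by
  refine max_eq_left ?_
  rcases h with h | h
  · linarith [neg_abs_le (‖x‖ - 4 * r)]
  · linarith [le_abs_self (‖x‖ - 4 * r)]

lemma abs_norm_add_latUnit_sub_le (x : Fin d → ℤ) (j : Fin d) :
    |‖x + latUnit d j‖ - ‖x‖| ≤ 1 := by
  have h : ‖latUnit d j‖ ≤ 1 := by
    rw [pi_norm_le_iff_of_nonneg zero_le_one]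
    intro i
    unfold latUnit
    split_ifs <;> simp
  have := abs_norm_sub_norm_le (x + latUnit d j) x
  rw [add_sub_cancel_left] at this
  exact this.trans h

lemma abs_annularTent_sub_le (r : ℝ) (x : Fin d → ℤ) (j : Fin d) :
    |annularTent r (x + latUnit d j) - annularTent r x| ≤ 1 := by
  have h1 := abs_norm_add_latUnit_sub_le x j
  have h2 := abs_max_sub_max_le_abs (2 * r - |‖x + latUnit d j‖ - 4 * r|) (2 * r - |‖x‖ - 4 * r|) 0
  have h3 := abs_abs_sub_abs_le_abs_sub (‖x + latUnit d j‖ - 4 * r) (‖x‖ - 4 * r)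
  simp only [annularTent, max_comm (0 : ℝ)]
  refine h2.trans ?_
  rw [show 2 * r - |‖x + latUnit d j‖ - 4 * r| - (2 * r - |‖x‖ - 4 * r|)
    = -(|‖x + latUnit d j‖ - 4 * r| - |‖x‖ - 4 * r|) by ring, abs_neg]
  refine h3.trans ?_
  rwa [show ‖x + latUnit d j‖ - 4 * r - (‖x‖ - 4 * r) = ‖x + latUnit d j‖ - ‖x‖ by ring]

lemma annularTent_sub_eq_zero {r : ℝ} {x : Fin d → ℤ} (j : Fin d)
    (h : ‖x‖ ≤ 2 * r - 1 ∨ 6 * r + 1 ≤ ‖x‖) :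
    annularTent r (x + latUnit d j) - annularTent r x = 0 := by
  have h1 := abs_le.mp (abs_norm_add_latUnit_sub_le x j)
  rw [annularTent_eq_zero (by rcases h with h | h <;> [left; right] <;> linarith),
    annularTent_eq_zero (by rcases h with h | h <;> [left; right] <;> linarith), sub_zero]

lemma mem_piFinset_Icc_of_norm_le {m : ℕ} {x : Fin d → ℤ} (h : ‖x‖ ≤ m) :
    x ∈ Fintype.piFinset fun _ : Fin d => Finset.Icc (-(m : ℤ)) m := by
  rw [Fintype.mem_piFinset]
  intro i
  have h1 := (norm_le_pi_norm x i).trans h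
  rw [Int.norm_eq_abs] at h1
  have h2 : |x i| ≤ (m : ℤ) := by exact_mod_cast h1
  rw [Finset.mem_Icc]
  exact abs_le.mp h2

lemma finite_support_annularTent (m : ℕ) :
    (Function.support fun x : Fin d → ℤ => (annularTent (m : ℝ) x : ℂ)).Finite := by
  refine (Finset.finite_toSet
    (Fintype.piFinset fun _ : Fin d => Finset.Icc (-((6 * m : ℕ) : ℤ)) (6 * m : ℕ))).subset
    fun x hx => ?_
  by_contra hx'
  refine hx ?_
  have h : 6 * (m : ℝ) ≤ ‖x‖ := by
    by_contra! hlt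
    exact hx' (mem_piFinset_Icc_of_norm_le (by push_cast; exact hlt.le))
  simp [annularTent_eq_zero (Or.inr h)]

lemma tsum_gradSq_annularTent_le {m : ℕ} (hm : 1 ≤ m) :
    ∑' x : Fin d → ℤ, gradSq (fun x => (annularTent (m : ℝ) x : ℂ)) x ≤ d * (15 * m : ℝ) ^ d := by
  have hm' : (1 : ℝ) ≤ m := by exact_mod_cast hm
  let T := Fintype.piFinset fun _ : Fin d => Finset.Icc (-((7 * m : ℕ) : ℤ)) (7 * m : ℕ)
  have hdiff : ∀ (x : Fin d → ℤ) j, ‖(annularTent (m : ℝ) (x + latUnit d j) : ℂ)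
      - (annularTent (m : ℝ) x : ℂ)‖ = |annularTent (m : ℝ) (x + latUnit d j)
        - annularTent (m : ℝ) x| := fun x j => by
    rw [← Complex.ofReal_sub, Complex.norm_real, Real.norm_eq_abs]
  have h0 : ∀ x ∉ T, gradSq (fun x => (annularTent (m : ℝ) x : ℂ)) x = 0 := by
    intro x hx
    have h : 6 * (m : ℝ) + 1 ≤ ‖x‖ := by
      by_contra! hlt
      exact hx (mem_piFinset_Icc_of_norm_le (by push_cast; linarith))
    refine Finset.sum_eq_zero fun j _ => ?_
    rw [hdiff, annularTent_sub_eq_zero j (Or.inr h)]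
    simp
  rw [tsum_eq_sum h0]
  have hcard : (T.card : ℝ) ≤ (15 * m : ℝ) ^ d := by
    have h1 : T.card = (14 * m + 1) ^ d := by
      rw [Fintype.card_piFinset_const, Int.card_Icc]
      congr 1
      omega
    rw [h1]
    push_cast
    gcongr
    linarith
  calc ∑ x ∈ T, gradSq (fun x => (annularTent (m : ℝ) x : ℂ)) x ≤ ∑ x ∈ T, (d : ℝ) := by
        refine Finset.sum_le_sum fun x _ => ?_
        calc _ ≤ ∑ j : Fin d, (1 : ℝ) := Finset.sum_le_sum fun j _ => by
              rw [hdiff]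
              exact pow_le_one₀ (abs_nonneg _) (abs_annularTent_sub_le _ x j)
          _ = d := by simp
    _ = d * T.card := by rw [Finset.sum_const, nsmul_eq_mul, mul_comm]
    _ ≤ _ := by gcongr

lemma le_tsum_mul_annularTent (hd : 1 ≤ d) {V : (Fin d → ℤ) → ℝ}
    (hV : ∀ x, 0 ≤ V x) {m : ℕ} {A : ℝ}
    (hA : ∀ x : Fin d → ℤ, (∀ i, 4 * (m : ℤ) ≤ x i ∧ x i < 5 * m) → A / m ^ 2 ≤ V x)
    (hm : 1 ≤ m) :
    A * (m : ℝ) ^ d ≤ ∑' x, V x * ‖(annularTent (m : ℝ) x : ℂ)‖ ^ 2 := by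
  have hm' : (0 : ℝ) < m := by exact_mod_cast hm
  let T := Fintype.piFinset fun _ : Fin d => Finset.Ico (4 * m : ℤ) (5 * m)
  have hT : ∀ x ∈ T, ∀ i, 4 * (m : ℤ) ≤ x i ∧ x i < 5 * m := fun x hx i =>
    Finset.mem_Ico.mp (Fintype.mem_piFinset.mp hx i)
  have hcard : T.card = m ^ d := by
    rw [Fintype.card_piFinset_const, Int.card_Ico]
    congr 1
    omega
  have hval : ∀ x ∈ T, (m : ℝ) ≤ annularTent (m : ℝ) x := by
    intro x hx
    have h1 : ‖x‖ ≤ 5 * m := by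
      rw [pi_norm_le_iff_of_nonneg (by positivity)]
      intro i
      obtain ⟨h1, h2⟩ := hT x hx i
      rw [Int.norm_eq_abs]
      have : |x i| ≤ 5 * (m : ℤ) := abs_le.mpr ⟨by omega, h2.le⟩
      exact_mod_cast this
    have h2 : 4 * (m : ℝ) ≤ ‖x‖ := by
      refine le_trans ?_ (norm_le_pi_norm x ⟨0, hd⟩)
      rw [Int.norm_eq_abs]
      have := (hT x hx ⟨0, hd⟩).1.trans (le_abs_self _)
      exact_mod_cast this
    refine le_max_of_le_right ?_
    rw [abs_of_nonneg (by linarith)]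
    linarith
  calc A * (m : ℝ) ^ d = ∑ x ∈ T, A / m ^ 2 * (m : ℝ) ^ 2 := by
        rw [Finset.sum_const, hcard, nsmul_eq_mul]
        push_cast
        field_simp
    _ ≤ ∑ x ∈ T, V x * ‖(annularTent (m : ℝ) x : ℂ)‖ ^ 2 := by
        refine Finset.sum_le_sum fun x hx => ?_
        have h1 := hval x hx
        have h2 := hA x (hT x hx)
        have h3 := hV x
        rw [Complex.norm_real, Real.norm_of_nonneg (by linarith)]
        gcongr
    _ ≤ _ := (summable_of_finite_support_mul (finite_support_annularTent m) V).sum_le_tsum _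
        fun x _ => mul_nonneg (hV x) (by positivity)

lemma exPot_ge (hd : 3 ≤ d) {q : ℝ} (hq : 0 < q) {k N : ℕ} (hk : k < N) (x : Fin d → ℤ)
    (hx : ∀ i, 4 * ((4 ^ k : ℕ) : ℤ) ≤ x i ∧ x i < 5 * (4 ^ k : ℕ)) :
    1 / (25 * d) * (N * Real.log (400 * d)) ^ (-(1 / q)) / ((4 ^ k : ℕ) : ℝ) ^ 2 ≤ exPot d q x := by
  set r : ℝ := ((4 ^ k : ℕ) : ℝ) with hr
  have hr1 : 1 ≤ r := by rw [hr]; exact_mod_cast Nat.one_le_pow _ _ (by norm_num)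
  have hd' : (3 : ℝ) ≤ d := by exact_mod_cast hd
  have hlow : 16 * r ^ 2 ≤ normSqZ x := by
    refine le_trans ?_ (sq_le_normSqZ x ⟨0, by omega⟩)
    have h1 : 4 * r ≤ x ⟨0, by omega⟩ := by
      rw [hr]; exact_mod_cast (hx ⟨0, by omega⟩).1
    nlinarith
  have hup : normSqZ x ≤ 25 * d * r ^ 2 := by
    calc normSqZ x ≤ ∑ _i : Fin d, 25 * r ^ 2 := by
          refine Finset.sum_le_sum fun i _ => ?_
          have h1 : 4 * r ≤ x i := by rw [hr]; exact_mod_cast (hx i).1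
          have h2 : x i ≤ 5 * r := by rw [hr]; exact_mod_cast (hx i).2.le
          nlinarith
      _ = _ := by simp; ring
  have hn1 : 1 < normSqZ x := by nlinarith
  have hz : 1 < znorm x := by
    change 1 < Real.sqrt (normSqZ x)
    rw [Real.lt_sqrt (by norm_num)]
    linarith
  have hlogpos : 0 < Real.log (znorm x) := Real.log_pos hz
  have hlog : Real.log (znorm x) ≤ N * Real.log (400 * d) := by
    have e : Real.log (znorm x) = Real.log (normSqZ x) / 2 := Real.log_sqrt (normSqZ_nonneg x)
    have h0 : 0 < Real.log (normSqZ x) := Real.log_pos hn1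
    have h1 : normSqZ x ≤ (400 * d) ^ N := by
      have e2 : r ^ 2 = 16 ^ k := by
        rw [hr]
        push_cast
        rw [← pow_mul, mul_comm, pow_mul]
        norm_num
      calc normSqZ x ≤ 25 * d * 16 ^ k := by rw [← e2]; exact hup
        _ ≤ (400 * d) * (400 * d) ^ k := by gcongr <;> linarith
        _ = (400 * d) ^ (k + 1) := by ring
        _ ≤ _ := pow_le_pow_right₀ (by linarith) hk
    have h2 := Real.log_le_log (by linarith) h1
    rw [Real.log_pow] at h2
    linarith
  rw [exPot_eq hz]
  have h1 : (N * Real.log (400 * d)) ^ (-(1 / q)) ≤ Real.log (znorm x) ^ (-(1 / q)) :=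
    Real.rpow_le_rpow_of_nonpos hlogpos hlog (by
      have : 0 < 1 / q := by positivity
      linarith)
  have h2 : (25 * d * r ^ 2)⁻¹ ≤ (normSqZ x)⁻¹ := inv_anti₀ (by linarith) hup
  have h3 : 0 ≤ (N * Real.log (400 * d)) ^ (-(1 / q)) :=
    Real.rpow_nonneg (hlogpos.le.trans hlog) _
  calc _ = (25 * d * r ^ 2)⁻¹ * (N * Real.log (400 * d)) ^ (-(1 / q)) := by
        field_simp
    _ ≤ _ := by gcongr

lemma le_nCount_exPot (hd : 3 ≤ d) {q : ℝ} (hq : 0 < q) {s : ℝ} (hs : 0 ≤ s) {N : ℕ}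
    (hsN : s * (d * 15 ^ d) < 1 / (25 * d) * (N * Real.log (400 * d)) ^ (-(1 / q))) :
    (N : ℕ∞) ≤ nCount d (exPot d q) s := by
  have hr1 : ∀ k : ℕ, (1 : ℝ) ≤ ((4 ^ k : ℕ) : ℝ) := fun k => by
    exact_mod_cast Nat.one_le_pow _ _ (by norm_num)
  have hsep : ∀ {k l : ℕ}, k < l → 4 * ((4 ^ k : ℕ) : ℝ) ≤ ((4 ^ l : ℕ) : ℝ) := by
    intro k l h
    have : 4 ^ (k + 1) ≤ 4 ^ l := Nat.pow_le_pow_right (by norm_num) h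
    rw [pow_succ] at this
    exact_mod_cast (by linarith : 4 * 4 ^ k ≤ 4 ^ l)
  refine le_nCount_of_disjoint (exPot_nonneg q) hs
    (fun (k : Fin N) x => (annularTent ((4 ^ (k : ℕ) : ℕ) : ℝ) x : ℂ))
    (fun k => finite_support_annularTent _) ?_ ?_ ?_
  · intro x k l hkl
    wlog h : k < l generalizing k l
    · exact (this l k hkl.symm (lt_of_le_of_ne (not_lt.mp h) hkl.symm)).symm
    have h1 := hsep h
    have h2 := hr1 k
    rcases le_total ‖x‖ (2 * ((4 ^ (l : ℕ) : ℕ) : ℝ)) with h3 | h3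
    · right
      rw [annularTent_eq_zero (Or.inl h3), Complex.ofReal_zero]
    · left
      rw [annularTent_eq_zero (Or.inr (by linarith)), Complex.ofReal_zero]
  · intro x j k l hkl
    wlog h : k < l generalizing k l
    · exact (this l k hkl.symm (lt_of_le_of_ne (not_lt.mp h) hkl.symm)).symm
    have h1 := hsep h
    have h2 := hr1 k
    simp only [← Complex.ofReal_sub]
    rcases le_total ‖x‖ (2 * ((4 ^ (l : ℕ) : ℕ) : ℝ) - 1) with h3 | h3
    · right
      rw [annularTent_sub_eq_zero j (Or.inl h3), Complex.ofReal_zero]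
    · left
      rw [annularTent_sub_eq_zero j (Or.inr (by linarith)), Complex.ofReal_zero]
  · intro k
    have hm : 1 ≤ 4 ^ (k : ℕ) := Nat.one_le_pow _ _ (by norm_num)
    have h1 := tsum_gradSq_annularTent_le (d := d) hm
    have h2 := le_tsum_mul_annularTent (by omega) (exPot_nonneg q)
      (exPot_ge hd hq k.isLt) hm
    refine lt_of_le_of_lt (mul_le_mul_of_nonneg_left h1 hs) (lt_of_lt_of_le ?_ h2)
    rw [mul_pow, ← mul_assoc (d : ℝ), ← mul_assoc s]
    have := hr1 k
    exact mul_lt_mul_of_pos_right hsN (by positivity)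

lemma exPot_lower (hd : 3 ≤ d) {q : ℝ} (hq : 0 < q) :
    0 < Filter.limsup (fun s : ℝ =>
      ENNReal.ofReal (s ^ q) * (nCount d (exPot d q) s : ℝ≥0∞)) (𝓝[>] (0 : ℝ)) := by
  have hd' : (3 : ℝ) ≤ d := by exact_mod_cast hd
  set Λ : ℝ := Real.log (400 * d) with hΛ
  have hΛ0 : 0 < Λ := Real.log_pos (by linarith)
  set c : ℝ := 1 / (25 * d) / (d * 15 ^ d) / 2 with hc
  have hc0 : 0 < c := by positivity
  let σ : ℕ → ℝ := fun N => c * (((N : ℝ) + 1) * Λ) ^ (-(1 / q))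
  have hσ0 : ∀ N, 0 < σ N := fun N => by positivity
  have hlim : Tendsto σ atTop (𝓝[>] 0) := by
    refine tendsto_nhdsWithin_iff.mpr ⟨?_, Eventually.of_forall hσ0⟩
    have h1 : Tendsto (fun N : ℕ => ((N : ℝ) + 1) * Λ) atTop atTop :=
      (tendsto_atTop_add_const_right _ 1 tendsto_natCast_atTop_atTop).atTop_mul_const hΛ0
    have h2 := ((tendsto_rpow_neg_atTop (show 0 < 1 / q by positivity)).comp h1).const_mul c
    rwa [mul_zero] at h2
  have hbound : ∀ N, ENNReal.ofReal (c ^ q / Λ)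
      ≤ ENNReal.ofReal (σ N ^ q) * (nCount d (exPot d q) (σ N) : ℝ≥0∞) := by
    intro N
    have hcount : ((N + 1 : ℕ) : ℕ∞) ≤ nCount d (exPot d q) (σ N) := by
      refine le_nCount_exPot hd hq (hσ0 N).le ?_
      push_cast
      set b : ℝ := (((N : ℝ) + 1) * Λ) ^ (-(1 / q)) with hb
      have hb0 : 0 < b := by positivity
      have e : σ N * (d * 15 ^ d) = 1 / (25 * d) * b / 2 := by
        simp only [σ, ← hb, hc]
        field_simp
      have : 0 < 1 / (25 * d) * b := by positivity
      rw [e]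
      linarith
    have hcount' : ((N + 1 : ℕ) : ℝ≥0∞) ≤ (nCount d (exPot d q) (σ N) : ℝ≥0∞) := by
      rw [← ENat.toENNReal_coe]
      exact ENat.toENNReal_le.mpr hcount
    refine le_trans ?_ (mul_le_mul_right hcount' _)
    rw [← ENNReal.ofReal_natCast, ← ENNReal.ofReal_mul (by have := hσ0 N; positivity)]
    refine ENNReal.ofReal_le_ofReal (le_of_eq ?_)
    simp only [σ]
    rw [Real.mul_rpow hc0.le (by positivity), ← Real.rpow_mul (by positivity), neg_mul,
      one_div_mul_cancel hq.ne', Real.rpow_neg_one]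
    push_cast
    field_simp
  refine lt_of_lt_of_le (ENNReal.ofReal_pos.mpr (show 0 < c ^ q / Λ by positivity)) ?_
  exact le_limsup_of_frequently_le (hlim.frequently (Eventually.of_forall hbound).frequently)

end LowerBound

/-- for the potential `exPot`, `n(s,V) = O(s^{−q})` but
`s^q n(s,V)` does not tend to `0` as `s → 0⁺` (positive limsup): the estimate is
order-sharp. -/
theorem example_order_sharp (d : ℕ) (hd : 3 ≤ d) (q : ℝ) (hq : (d : ℝ) < 2 * q) :
    (∃ C : ℝ, ∀ s : ℝ, 0 < s →
        ENNReal.ofReal (s ^ q) * (nCount d (exPot d q) s : ℝ≥0∞) ≤ ENNReal.ofReal C) ∧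
      0 < Filter.limsup (fun s : ℝ =>
          ENNReal.ofReal (s ^ q) * (nCount d (exPot d q) s : ℝ≥0∞)) (𝓝[>] (0 : ℝ)) := by
  have hd' : (3 : ℝ) ≤ d := by exact_mod_cast hd
  exact ⟨⟨_, fun s hs => exPot_upper hd hq hs⟩, exPot_lower hd (by linarith)⟩
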